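/- Let f : [0,1] → [0,1] be continuous, let 𝓘 be a cycle of f with q intervals, and let x ∈ ∪𝓘 be a periodic point of f with minimal period p. Then q divides p; in particular p ≥ q. -/

import Mathlib

/-- `f` is a piecewise affine map of `[0,1]` into itself: continuous, and affine with
nonzero slope on each interval of some finite partition `0 = a 0 < a 1 < ⋯ < a d = 1`. -/
def IsPLMap (f : ℝ → ℝ) : Prop :=
  ContinuousOn f (Set.Icc 0 1) ∧ Set.MapsTo f (Set.Icc 0 1) (Set.Icc 0 1) ∧
    ∃ (d : ℕ) (a s c : ℕ → ℝ), 1 ≤ d ∧ a 0 = 0 ∧ a d = 1 ∧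
      (∀ i < d, a i < a (i + 1)) ∧ (∀ i < d, s i ≠ 0) ∧
      (∀ i < d, ∀ x ∈ Set.Icc (a i) (a (i + 1)), f x = s i * x + c i)

/-- The set of corner points of `f`: interior points of `[0,1]` where the two
one-sided derivatives (slopes) of `f` differ. -/
def cornerSet (f : ℝ → ℝ) : Set ℝ :=
  {x | x ∈ Set.Ioo (0 : ℝ) 1 ∧
    derivWithin f (Set.Ici x) x ≠ derivWithin f (Set.Iic x) x}

/-- `V = Var(log |Df|)`, the total variation of `log |Df|` over `[0,1]`, i.e. the sum
over the corner points of `f` of the jumps of `log |Df|` there. -/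
noncomputable def logSlopeVar (f : ℝ → ℝ) : ℝ :=
  ∑ᶠ x ∈ cornerSet f,
    |Real.log (|derivWithin f (Set.Ici x) x|) - Real.log (|derivWithin f (Set.Iic x) x|)|

/-- `I 0, …, I (q-1)` is a cycle of `f`: pairwise disjoint nondegenerate closed
subintervals of `[0,1]` mapped cyclically into one another by `f`. -/
def IsCycle (f : ℝ → ℝ) (q : ℕ) (I : ℕ → Set ℝ) : Prop :=
  1 ≤ q ∧ (∀ j < q, ∃ u v : ℝ, u < v ∧ I j = Set.Icc u v) ∧
    (∀ j < q, I j ⊆ Set.Icc 0 1) ∧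
    (∀ i < q, ∀ j < q, i ≠ j → Disjoint (I i) (I j)) ∧
    (∀ j < q, f '' I j ⊆ I ((j + 1) % q))

/-- The union `∪𝓘` of the intervals of a cycle. -/
def cycleUnion (q : ℕ) (I : ℕ → Set ℝ) : Set ℝ := ⋃ j < q, I j

/-- `𝓘¹ ⊃ 𝓘²`, the cycles are nested: every interval of the cycle `𝓘²` is contained in
some interval of the cycle `𝓘¹`, and the two collections of intervals are different. -/
def CycleNested (q₁ : ℕ) (I1 : ℕ → Set ℝ) (q₂ : ℕ) (I2 : ℕ → Set ℝ) : Prop :=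
  (∀ j < q₂, ∃ i < q₁, I2 j ⊆ I1 i) ∧ I2 '' Set.Iio q₂ ≠ I1 '' Set.Iio q₁

/-- `G` is a gap of the cycle `I2`, with left neighbour `I2 l` and right neighbour
`I2 r`: an open interval disjoint from `∪𝓘²` lying strictly between the two adjacent
intervals `I2 l` and `I2 r` (whose closures it meets). -/
def IsGap (q₂ : ℕ) (I2 : ℕ → Set ℝ) (l r : ℕ) (G : Set ℝ) : Prop :=
  l < q₂ ∧ r < q₂ ∧
    ∃ a b : ℝ, a < b ∧ G = Set.Ioo a b ∧
      a ∈ I2 l ∧ (∀ y ∈ I2 l, y ≤ a) ∧ b ∈ I2 r ∧ (∀ y ∈ I2 r, b ≤ y) ∧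
      ∀ j < q₂, Disjoint G (I2 j)

/-- `P` is a splitting for the nested pair of cycles `𝓘¹ ⊃ 𝓘²`: a finite union of
periodic orbits of `f` such that every point of `P` lies in a gap and every gap
contains exactly one point of `P`. -/
def IsSplitting (f : ℝ → ℝ) (q₁ : ℕ) (I1 : ℕ → Set ℝ) (q₂ : ℕ) (I2 : ℕ → Set ℝ)
    (P : Set ℝ) : Prop :=
  P.Finite ∧ Set.MapsTo f P P ∧ (∀ x ∈ P, ∃ p, 1 ≤ p ∧ f^[p] x = x) ∧
    (∀ x ∈ P, ∃ i < q₁, ∃ l r G, IsGap q₂ I2 l r G ∧ G ⊆ I1 i ∧ x ∈ G) ∧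
    (∀ i < q₁, ∀ l r G, IsGap q₂ I2 l r G → G ⊆ I1 i → ∃! x, x ∈ P ∩ G)

/-- The cycle `I2` (with `q₂` intervals) is a doubling of the cycle `I` (with `q`
intervals): `I` is a cycle, `𝓘 ⊃ 𝓘²`, and `q₂ = 2q`. -/
def IsDoublingOf (f : ℝ → ℝ) (q₂ : ℕ) (I2 : ℕ → Set ℝ) (q : ℕ) (I : ℕ → Set ℝ) : Prop :=
  IsCycle f q I ∧ CycleNested q I q₂ I2 ∧ q₂ = 2 * q

/-- `x` is a periodic point of `f` of minimal period `p`. -/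
def MinimalPeriod (f : ℝ → ℝ) (x : ℝ) (p : ℕ) : Prop :=
  1 ≤ p ∧ f^[p] x = x ∧ ∀ k, 1 ≤ k → k < p → f^[k] x ≠ x

theorem IsCycle.iterate_mem {f : ℝ → ℝ} {q : ℕ} {I : ℕ → Set ℝ} (hI : IsCycle f q I)
    {j : ℕ} (hj : j < q) {x : ℝ} (hx : x ∈ I j) (n : ℕ) : f^[n] x ∈ I ((j + n) % q) := by
  obtain ⟨hq, -, -, -, hmap⟩ := hI
  induction n with
  | zero => simpa [Nat.mod_eq_of_lt hj] using hx
  | succ n ih =>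
    have h := hmap _ (Nat.mod_lt (j + n) hq) (Set.mem_image_of_mem f ih)
    rwa [Nat.mod_add_mod, add_assoc, ← Function.iterate_succ_apply' f n x] at h

/-- If `𝓘` is a cycle of a continuous map `f : [0,1] → [0,1]` with `q` intervals and
`x ∈ ∪𝓘` is a periodic point of minimal period `p`, then `q ∣ p`; in particular
`p ≥ q`. -/
theorem cycle_divides_period (f : ℝ → ℝ)
    (hf : ContinuousOn f (Set.Icc 0 1))
    (hmaps : Set.MapsTo f (Set.Icc 0 1) (Set.Icc 0 1))
    (q : ℕ) (I : ℕ → Set ℝ) (hI : IsCycle f q I)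
    (x : ℝ) (hx : x ∈ cycleUnion q I)
    (p : ℕ) (hper : MinimalPeriod f x p) :
    q ∣ p ∧ q ≤ p := by
  obtain ⟨j, hj, hxj⟩ := Set.mem_iUnion₂.mp hx
  obtain ⟨hp, hfix, -⟩ := hper
  have hmem := hI.iterate_mem hj hxj p
  rw [hfix] at hmem
  obtain ⟨hq, -, -, hdisj, -⟩ := hI
  have hidx : (j + p) % q = j := by
    by_contra hne
    exact Set.disjoint_left.mp (hdisj _ (Nat.mod_lt _ hq) j hj hne) hmem hxj
  have hdvd : q ∣ p := by
    have hmod : j + 0 ≡ j + p [MOD q] := by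
      simp [Nat.ModEq, hidx, Nat.mod_eq_of_lt hj]
    exact (Nat.modEq_zero_iff_dvd).mp (Nat.ModEq.add_left_cancel' j hmod).symm
  exact ⟨hdvd, Nat.le_of_dvd hp hdvd⟩
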